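/- Let n ≥ 2 and let T : ℝ^n → ℝ^m be a linear map. Then the set {μ_T(P) : P a proper n-system} is a compact subset of ℝ^m. -/

import Mathlib

open Filter Set Pointwise Topology

noncomputable section

/-- Points of `ℝ^n`. -/
abbrev RVec (n : ℕ) := Fin n → ℝ

/-- The vector of `ℝ^n` with a `1` in position `j` (0-based) and `0` elsewhere;
`eVec n 0` is the first canonical basis vector `e_1`. -/
def eVec (n : ℕ) (j : ℕ) : RVec n := fun i => if (i : ℕ) = j then 1 else 0

/-- `P` is an `n`-system on the subinterval `I` of `[0,∞)`:
`I` is an order-connected subset of `[0,∞)` with nonempty interior, and conditions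
(S1), (S2), (S3) hold at every `q ∈ I`. -/
def IsNSystem (n : ℕ) (I : Set ℝ) (P : ℝ → RVec n) : Prop :=
  I ⊆ Set.Ici (0 : ℝ) ∧ I.OrdConnected ∧ (interior I).Nonempty ∧
  ∀ q ∈ I,
    ((∀ i, 0 ≤ P q i) ∧ Monotone (P q) ∧ (∑ i, P q i) = q) ∧
    ∃ ε > (0 : ℝ), ∃ k ℓ : Fin n,
      (∀ t ∈ I ∩ Set.Icc (q - ε) q, P t = P q + (t - q) • eVec n ℓ) ∧
      (∀ t ∈ I ∩ Set.Icc q (q + ε), P t = P q + (t - q) • eVec n k) ∧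
      (q ∈ interior I → ℓ < k → ∀ i : Fin n, ℓ ≤ i → i ≤ k → P q i = P q ℓ)

/-- `P` is a proper `n`-system on `I`: it is an `n`-system whose first component is
unbounded (by the monotonicity (S1) of the components, this is equivalent to all
components simultaneously exceeding any given bound). -/
def IsProperSys (n : ℕ) (I : Set ℝ) (P : ℝ → RVec n) : Prop :=
  IsNSystem n I P ∧ ∀ M : ℝ, ∃ q ∈ I, ∀ i, M < P q i

/-- The set `F(P)` of limits of `q_i⁻¹ • P(q_i)` along strictly increasing unbounded
sequences `(q_i)` in `I`. -/
def FSet (n : ℕ) (I : Set ℝ) (P : ℝ → RVec n) : Set (RVec n) :=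
  {x | ∃ q : ℕ → ℝ, (∀ i, q i ∈ I) ∧ StrictMono q ∧
    Tendsto q atTop atTop ∧ Tendsto (fun i => (q i)⁻¹ • P (q i)) atTop (𝓝 x)}

/-- The set `F(P, e₁)`: as `F(P)`, but with the extra requirement that the right
derivative of `P` at each `q_i` is the first basis vector `e_1`. -/
def FSetE1 (n : ℕ) (I : Set ℝ) (P : ℝ → RVec n) : Set (RVec n) :=
  {x | ∃ q : ℕ → ℝ, (∀ i, q i ∈ I) ∧ StrictMono q ∧ Tendsto q atTop atTop ∧
    (∀ i, ∃ ε > (0 : ℝ), ∀ t ∈ I ∩ Set.Icc (q i) (q i + ε),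
      P t = P (q i) + (t - q i) • eVec n 0) ∧
    Tendsto (fun i => (q i)⁻¹ • P (q i)) atTop (𝓝 x)}

/-- `q` is a switch number of the `n`-system `P` on `I`: a point of `I` on the boundary
of `I`, or an interior point where the local slopes `e_k` (right) and `e_ℓ` (left)
from (S2) satisfy `k < ℓ`. -/
def IsSwitchNumber (n : ℕ) (I : Set ℝ) (P : ℝ → RVec n) (q : ℝ) : Prop :=
  q ∈ I ∧ (q ∈ frontier I ∨
    (q ∈ interior I ∧ ∃ ε > (0 : ℝ), ∃ k ℓ : Fin n, k < ℓ ∧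
      (∀ t ∈ I ∩ Set.Icc (q - ε) q, P t = P q + (t - q) • eVec n ℓ) ∧
      (∀ t ∈ I ∩ Set.Icc q (q + ε), P t = P q + (t - q) • eVec n k)))

/-- `q` is a division number of the `n`-system `P` on `I`: a point of `I` on the boundary
of `I`, or an interior point where `P` is not differentiable, i.e. where the left and
right slopes from (S2) differ. -/
def IsDivisionNumber (n : ℕ) (I : Set ℝ) (P : ℝ → RVec n) (q : ℝ) : Prop :=
  q ∈ I ∧ (q ∈ frontier I ∨
    (q ∈ interior I ∧ ∃ ε > (0 : ℝ), ∃ k ℓ : Fin n, k ≠ ℓ ∧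
      (∀ t ∈ I ∩ Set.Icc (q - ε) q, P t = P q + (t - q) • eVec n ℓ) ∧
      (∀ t ∈ I ∩ Set.Icc q (q + ε), P t = P q + (t - q) • eVec n k)))

/-- A non-degenerate `n`-system: an `n`-system whose domain is a closed subinterval
of `(0,∞)` and whose switch points all have `n` distinct positive coordinates. -/
def IsNonDegenerate (n : ℕ) (I : Set ℝ) (P : ℝ → RVec n) : Prop :=
  IsNSystem n I P ∧ IsClosed I ∧ I ⊆ Set.Ioi (0 : ℝ) ∧
  ∀ q, IsSwitchNumber n I P q → (∀ i, 0 < P q i) ∧ StrictMono (P q)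

/-- A rigid `n`-system of mesh `δ`: a non-degenerate `n`-system whose switch points
belong to `δℤ^n`. -/
def IsRigid (n : ℕ) (δ : ℝ) (I : Set ℝ) (P : ℝ → RVec n) : Prop :=
  IsNonDegenerate n I P ∧
  ∀ q, IsSwitchNumber n I P q → ∀ i, ∃ m : ℤ, P q i = δ * m

/-- A self-similar system: the domain is unbounded and there is `ρ > 1` with
`P(ρq) = ρ • P(q)` for all `q` in the domain. -/
def IsSelfSimilar (n : ℕ) (I : Set ℝ) (P : ℝ → RVec n) : Prop :=
  ¬ BddAbove I ∧ ∃ ρ : ℝ, 1 < ρ ∧ ∀ q ∈ I, ρ * q ∈ I ∧ P (ρ * q) = ρ • P q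

/-- The cube `[-ε, ε]^n`. -/
def cubeNbhd (n : ℕ) (ε : ℝ) : Set (RVec n) := {y | ∀ i, |y i| ≤ ε}

/-- The distance `dist(E, F)`: the infimum of all `ε > 0` such that
`E ⊆ F + [-ε,ε]^n` and `F ⊆ E + [-ε,ε]^n`. -/
def cubeDist (n : ℕ) (E F : Set (RVec n)) : ℝ :=
  sInf {ε : ℝ | 0 < ε ∧ E ⊆ F + cubeNbhd n ε ∧ F ⊆ E + cubeNbhd n ε}

/-- `μ_T(P)`: the point of `ℝ^m` whose `j`-th coordinate is
`liminf_{q → ∞, q ∈ I} T_j(P(q))/q`. -/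
def muT (n m : ℕ) (T : RVec n → RVec m) (I : Set ℝ) (P : ℝ → RVec n) : RVec m :=
  fun j => Filter.liminf (fun q => T (P q) j / q) (atTop ⊓ 𝓟 I)

/-- `liminf` of a sequence of subsets of `ℝ^n`: the set of limits of convergent
sequences `(x_i)` with `x_i ∈ F i` for every `i`. -/
def setLiminf (n : ℕ) (F : ℕ → Set (RVec n)) : Set (RVec n) :=
  {x | ∃ y : ℕ → RVec n, (∀ i, y i ∈ F i) ∧ Tendsto y atTop (𝓝 x)}

/-- `limsup` of a sequence of subsets of `ℝ^n`: the set of accumulation points of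
sequences `(x_i)` with `x_i ∈ F i` for every `i`, i.e. limits of convergent
subsequences. -/
def setLimsup (n : ℕ) (F : ℕ → Set (RVec n)) : Set (RVec n) :=
  {x | ∃ (y : ℕ → RVec n) (φ : ℕ → ℕ), (∀ i, y i ∈ F i) ∧ StrictMono φ ∧
    Tendsto (y ∘ φ) atTop (𝓝 x)}

/-- Near `q`, on the right, `X` is affine with slope the basis vector of index `k`. -/
def HasRightSlope {n : ℕ} (X : ℝ → RVec n) (q : ℝ) (k : Fin n) : Prop :=
  ∀ᶠ t in 𝓝[≥] q, X t = X q + (t - q) • eVec n k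

/-- Near `q`, on the left, `X` is affine with slope the basis vector of index `ℓ`. -/
def HasLeftSlope {n : ℕ} (X : ℝ → RVec n) (q : ℝ) (ℓ : Fin n) : Prop :=
  ∀ᶠ t in 𝓝[≤] q, X t = X q + (t - q) • eVec n ℓ

/-- The defining conditions of an `n`-system at an interior point `q` of its domain, with right
slope of index `k` and left slope of index `ℓ`. -/
structure IsRegularAt {n : ℕ} (X : ℝ → RVec n) (q : ℝ) (k ℓ : Fin n) : Prop where
  nonneg : ∀ i, 0 ≤ X q i
  mono : Monotone (X q)
  sum : ∑ i, X q i = q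
  right : HasRightSlope X q k
  left : HasLeftSlope X q ℓ
  chain : ℓ < k → ∀ i : Fin n, ℓ ≤ i → i ≤ k → X q i = X q ℓ

/-- `X` satisfies the conditions of an `n`-system at every point of `[c, ∞)`. -/
def IsRegularFrom {n : ℕ} (X : ℝ → RVec n) (c : ℝ) : Prop :=
  ∀ q, c ≤ q → ∃ k ℓ, IsRegularAt X q k ℓ

@[simp]
lemma eVec_apply {n : ℕ} (k i : Fin n) : eVec n k i = if i = k then 1 else 0 := by
  simp [eVec, Fin.ext_iff]

lemma HasRightSlope.of_eventually {n : ℕ} {X : ℝ → RVec n} {I : Set ℝ} {q ε : ℝ} {k : Fin n}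
    (hI : I ∈ 𝓝 q) (hε : 0 < ε)
    (h : ∀ t ∈ I ∩ Set.Icc q (q + ε), X t = X q + (t - q) • eVec n k) : HasRightSlope X q k := by
  filter_upwards [mem_nhdsWithin_of_mem_nhds hI, Icc_mem_nhdsGE (show q < q + ε by linarith)]
    with t h1 h2 using h t ⟨h1, h2⟩

lemma HasLeftSlope.of_eventually {n : ℕ} {X : ℝ → RVec n} {I : Set ℝ} {q ε : ℝ} {ℓ : Fin n}
    (hI : I ∈ 𝓝 q) (hε : 0 < ε)
    (h : ∀ t ∈ I ∩ Set.Icc (q - ε) q, X t = X q + (t - q) • eVec n ℓ) : HasLeftSlope X q ℓ := by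
  filter_upwards [mem_nhdsWithin_of_mem_nhds hI, Icc_mem_nhdsLE (show q - ε < q by linarith)]
    with t h1 h2 using h t ⟨h1, h2⟩

lemma HasRightSlope.congr {n : ℕ} {X Y : ℝ → RVec n} {q : ℝ} {k : Fin n}
    (h : HasRightSlope X q k) (hXY : Y =ᶠ[𝓝[≥] q] X) : HasRightSlope Y q k := by
  have hq := hXY.self_of_nhdsWithin Set.self_mem_Ici
  filter_upwards [h, hXY] with t h1 h2
  rw [h2, h1, hq]

lemma HasLeftSlope.congr {n : ℕ} {X Y : ℝ → RVec n} {q : ℝ} {ℓ : Fin n}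
    (h : HasLeftSlope X q ℓ) (hXY : Y =ᶠ[𝓝[≤] q] X) : HasLeftSlope Y q ℓ := by
  have hq := hXY.self_of_nhdsWithin Set.self_mem_Iic
  filter_upwards [h, hXY] with t h1 h2
  rw [h2, h1, hq]

lemma HasRightSlope.exists_Icc {n : ℕ} {X : ℝ → RVec n} {q b : ℝ} {k : Fin n}
    (h : HasRightSlope X q k) (hb : q < b) :
    ∃ u ∈ Set.Ioc q b, ∀ t ∈ Set.Icc q u, X t = X q + (t - q) • eVec n k := by
  obtain ⟨u, hu, hsub⟩ := mem_nhdsGE_iff_exists_Icc_subset.1 h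
  exact ⟨min u b, ⟨lt_min hu hb, min_le_right _ _⟩,
    fun t ht => hsub ⟨ht.1, ht.2.trans (min_le_left _ _)⟩⟩

lemma HasLeftSlope.exists_Icc {n : ℕ} {X : ℝ → RVec n} {q a : ℝ} {ℓ : Fin n}
    (h : HasLeftSlope X q ℓ) (ha : a < q) :
    ∃ u ∈ Set.Ico a q, ∀ t ∈ Set.Icc u q, X t = X q + (t - q) • eVec n ℓ := by
  obtain ⟨u, hu, hsub⟩ := mem_nhdsLE_iff_exists_Icc_subset.1 h
  exact ⟨max u a, ⟨le_max_right _ _, max_lt hu ha⟩,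
    fun t ht => hsub ⟨(le_max_left _ _).trans ht.1, ht.2⟩⟩

namespace IsRegularAt

variable {n : ℕ} {X : ℝ → RVec n} {q : ℝ} {k ℓ : Fin n}

lemma continuousAt (h : IsRegularAt X q k ℓ) : ContinuousAt X q := by
  have aux : ∀ j : Fin n, Continuous fun t : ℝ => X q + (t - q) • eVec n j := fun j => by
    fun_prop
  rw [continuousAt_iff_continuous_left_right]
  exact ⟨(aux ℓ).continuousWithinAt.congr_of_eventuallyEq h.left (by simp),
    (aux k).continuousWithinAt.congr_of_eventuallyEq h.right (by simp)⟩

lemma apply_le (h : IsRegularAt X q k ℓ) (i : Fin n) : X q i ≤ q :=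
  (Finset.single_le_sum (fun j _ => h.nonneg j) (Finset.mem_univ i)).trans_eq h.sum

lemma congr {Y : ℝ → RVec n} (h : IsRegularAt X q k ℓ) (hXY : Y =ᶠ[𝓝 q] X) :
    IsRegularAt Y q k ℓ := by
  have hq := hXY.self_of_nhds
  refine ⟨?_, ?_, ?_, h.right.congr (hXY.filter_mono nhdsWithin_le_nhds),
    h.left.congr (hXY.filter_mono nhdsWithin_le_nhds), ?_⟩ <;> rw [hq]
  exacts [h.nonneg, h.mono, h.sum, h.chain]

end IsRegularAt

namespace IsRegularFrom

variable {n : ℕ} {X : ℝ → RVec n} {c : ℝ}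

lemma mono_left {d : ℝ} (h : IsRegularFrom X c) (hd : c ≤ d) : IsRegularFrom X d :=
  fun q hq => h q (hd.trans hq)

lemma continuousOn (h : IsRegularFrom X c) : ContinuousOn X (Set.Ici c) := fun q hq => by
  obtain ⟨k, ℓ, hk⟩ := h q hq
  exact hk.continuousAt.continuousWithinAt

lemma sum_eq (h : IsRegularFrom X c) {q : ℝ} (hq : c ≤ q) : ∑ i, X q i = q := by
  obtain ⟨k, ℓ, hk⟩ := h q hq
  exact hk.sum

lemma monotoneOn (h : IsRegularFrom X c) : MonotoneOn X (Set.Ici c) := by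
  intro a ha b hb hab i
  have hsub : Set.Icc a b ⊆ Set.Ici c := fun t ht => (Set.mem_Ici.1 ha).trans ht.1
  have hcl : IsClosed ({t | X a i ≤ X t i} ∩ Set.Icc a b) := by
    have h1 : ContinuousOn (fun t => X t i) (Set.Icc a b) :=
      (continuous_apply i).comp_continuousOn (h.continuousOn.mono hsub)
    have := h1.preimage_isClosed_of_isClosed isClosed_Icc (isClosed_Ici (a := X a i))
    rwa [Set.inter_comm] at this
  refine hcl.mem_of_ge_of_forall_exists_gt (by simp) hab ?_
  rintro t ⟨ht, hta, htb⟩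
  obtain ⟨k, ℓ, hk⟩ := h t ((Set.mem_Ici.1 ha).trans hta)
  obtain ⟨u, hu, hX⟩ := hk.right.exists_Icc htb
  refine ⟨u, ?_, hu⟩
  have := hX u ⟨hu.1.le, le_rfl⟩
  simp only [Set.mem_ofPred_eq] at ht ⊢
  rw [this]
  simp only [Pi.add_apply, Pi.smul_apply, eVec_apply, smul_eq_mul]
  have := hu.1
  split_ifs <;> linarith

end IsRegularFrom

lemma IsProperSys.exists_isRegularFrom {n : ℕ} (hn : 2 ≤ n) {I : Set ℝ} {P : ℝ → RVec n}
    (h : IsProperSys n I P) :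
    ∃ c : ℝ, 0 < c ∧ Set.Ici c ⊆ I ∧ IsRegularFrom P c := by
  obtain ⟨⟨hI0, hIo, -, hS⟩, hprop⟩ := h
  have hunb : ∀ M : ℝ, ∃ q ∈ I, M < q := fun M => by
    obtain ⟨q, hq, hM⟩ := hprop (max M 0)
    refine ⟨q, hq, ?_⟩
    have h1 := hM ⟨0, by omega⟩
    have h2 := Finset.single_le_sum (f := P q) (fun j _ => (hS q hq).1.1 j)
      (Finset.mem_univ (⟨0, by omega⟩ : Fin n))
    rw [(hS q hq).1.2.2] at h2
    exact (le_max_left _ _).trans_lt (h1.trans_le h2)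
  obtain ⟨c₀, hc₀, hpos⟩ := hunb 0
  have hsub : Set.Ici c₀ ⊆ I := fun t ht => by
    obtain ⟨q, hq, hqt⟩ := hunb t
    exact hIo.out hc₀ hq ⟨ht, hqt.le⟩
  refine ⟨c₀ + 1, by linarith, fun t ht => hsub (Set.mem_Ici.2 ?_), fun q hq => ?_⟩
  · have := Set.mem_Ici.1 ht
    linarith
  have hnhds : I ∈ 𝓝 q := mem_of_superset (Ici_mem_nhds (by linarith)) hsub
  obtain ⟨⟨h1, h2, h3⟩, ε, hε, k, ℓ, hl, hr, hc⟩ := hS q (mem_of_mem_nhds hnhds)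
  exact ⟨k, ℓ, h1, h2, h3, .of_eventually hnhds hε hr, .of_eventually hnhds hε hl,
    hc (mem_interior_iff_mem_nhds.2 hnhds)⟩

lemma isProperSys_Ioi {n : ℕ} {r : ℝ} (hr : 0 ≤ r) {Z : ℝ → RVec n}
    (hZ : ∀ q, r < q → ∃ k ℓ, IsRegularAt Z q k ℓ) (hprop : ∀ M : ℝ, ∃ q > r, ∀ i, M < Z q i) :
    IsProperSys n (Set.Ioi r) Z := by
  refine ⟨⟨fun q hq => hr.trans (Set.mem_Ioi.1 hq).le, Set.ordConnected_Ioi,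
    by rw [interior_Ioi]; exact Set.nonempty_Ioi, fun q hq => ?_⟩, hprop⟩
  obtain ⟨k, ℓ, h⟩ := hZ q hq
  obtain ⟨u, hu, hru⟩ := h.right.exists_Icc (lt_add_one q)
  obtain ⟨v, hv, hlv⟩ := h.left.exists_Icc (sub_one_lt q)
  refine ⟨⟨h.nonneg, h.mono, h.sum⟩, min (u - q) (q - v),
    lt_min (sub_pos.2 hu.1) (sub_pos.2 hv.2), k, ℓ, ?_, ?_, fun _ => h.chain⟩
  · rintro t ⟨-, ht1, ht2⟩
    exact hlv t ⟨by linarith [min_le_right (u - q) (q - v)], ht2⟩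
  · rintro t ⟨-, ht1, ht2⟩
    exact hru t ⟨ht1, by linarith [min_le_left (u - q) (q - v)]⟩

/-- A strictly increasing correspondence between two finite families of reals extends to a
continuous strictly increasing function displacing no point by more than the correspondence
does. -/
lemma exists_strictMono_extension {ι : Type*} [Finite ι] (u v : ι → ℝ)
    (h : ∀ i j, u i < u j ↔ v i < v j) {ε : ℝ} (h0 : 0 ≤ ε)
    (hε : ∀ i, |v i - u i| ≤ ε) :
    ∃ θ : ℝ → ℝ, StrictMono θ ∧ Continuous θ ∧ (∀ i, θ (u i) = v i) ∧ ∀ x, |θ x - x| ≤ ε := by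
  classical
  have := Fintype.ofFinite ι
  have hη : ∀ᶠ η in 𝓝[>] (0 : ℝ), ∀ i j, u i < u j → η * (u j - u i) ≤ v j - v i := by
    refine eventually_all.2 fun i => eventually_all.2 fun j => ?_
    by_cases hij : u i < u j
    · have h0 : Tendsto (fun η : ℝ => η * (u j - u i)) (𝓝[>] 0) (𝓝 (0 * (u j - u i))) :=
        ((continuous_id.mul continuous_const).tendsto _).mono_left nhdsWithin_le_nhds
      rw [zero_mul] at h0
      filter_upwards [h0.eventually (ge_mem_nhds (sub_pos.2 ((h i j).1 hij)))] with η hη _ using hη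
    · exact .of_forall fun _ h' => absurd h' hij
  have hL : ∀ᶠ L in atTop, ∀ i j, u i < u j → v j - v i ≤ L * (u j - u i) := by
    refine eventually_all.2 fun i => eventually_all.2 fun j => ?_
    by_cases hij : u i < u j
    · filter_upwards [(tendsto_id.atTop_mul_const (sub_pos.2 hij)).eventually_ge_atTop
        (v j - v i)] with L hL _ using hL
    · exact .of_forall fun _ h' => absurd h' hij
  obtain ⟨η, hη, hη0, hη1⟩ :=
    (hη.and (Ioc_mem_nhdsGT (zero_lt_one' ℝ))).exists
  obtain ⟨L, hL, hL1⟩ := (hL.and (eventually_ge_atTop 1)).exists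
  let f : Option ι → ℝ → ℝ := fun o x =>
    o.elim (x - ε) fun i => v i + min (η * (x - u i)) (L * (x - u i))
  have hfm : ∀ o, StrictMono (f o) := by
    rintro (_ | i) x y hxy
    · simpa [f] using hxy
    · have h1 : η * (x - u i) < η * (y - u i) := by gcongr
      have h2 : L * (x - u i) < L * (y - u i) := by
        have : 0 < L := by linarith
        gcongr
      exact add_lt_add_right (min_lt_min h1 h2) _
  have hfc : ∀ o, Continuous (f o) := by
    rintro (_ | i) <;> simp only [f, Option.elim] <;> fun_prop
  have hne : (Finset.univ : Finset (Option ι)).Nonempty := ⟨none, Finset.mem_univ _⟩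
  refine ⟨fun x => Finset.univ.sup' hne fun o => f o x, ?_, ?_, ?_, ?_⟩
  · intro x y hxy
    simp only [Finset.sup'_lt_iff]
    exact fun o _ => (hfm o hxy).trans_le (Finset.le_sup' (fun o => f o y) (Finset.mem_univ o))
  · exact Continuous.finset_sup'_apply hne fun o _ => hfc o
  · intro j
    refine le_antisymm (Finset.sup'_le _ _ ?_) ?_
    · rintro (_ | i) -
      · have := abs_le.1 (hε j)
        simp only [f, Option.elim]
        linarith
      · simp only [f, Option.elim]
        rcases lt_trichotomy (u i) (u j) with hij | hij | hij
        · linarith [hη i j hij, min_le_left (η * (u j - u i)) (L * (u j - u i))]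
        · have : v i = v j := le_antisymm (not_lt.1 fun h' => ((h _ _).2 h').ne' hij)
            (not_lt.1 fun h' => ((h _ _).2 h').ne hij)
          simp [hij, this]
        · linarith [hL j i hij, min_le_right (η * (u j - u i)) (L * (u j - u i))]
    · refine (Finset.le_sup' (fun o => f o (u j)) (Finset.mem_univ (some j))).trans' ?_
      simp [f]
  · intro x
    rw [abs_le]
    constructor
    · have := Finset.le_sup' (fun o => f o x) (Finset.mem_univ none)
      have h2 : f none x = x - ε := rfl
      linarith
    · rw [sub_le_iff_le_add]
      refine Finset.sup'_le _ _ ?_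
      rintro (_ | i) -
      · simp only [f, Option.elim]
        linarith
      · have := abs_le.1 (hε i)
        simp only [f, Option.elim]
        have hm : min (η * (x - u i)) (L * (x - u i)) ≤ x - u i := by
          rcases le_total (u i) x with hx | hx
          · exact (min_le_left _ _).trans (by nlinarith)
          · exact (min_le_right _ _).trans (by nlinarith)
        linarith

lemma IsRegularFrom.strictMonoOn_sum {n : ℕ} {X : ℝ → RVec n} {a : ℝ} (h : IsRegularFrom X a)
    {ψ : ℝ → ℝ} (hψ : StrictMono ψ) : StrictMonoOn (fun t => ∑ i, ψ (X t i)) (Set.Ici a) := by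
  intro s hs t ht hst
  have hle := h.monotoneOn hs ht hst.le
  refine Finset.sum_lt_sum (fun i _ => hψ.monotone (hle i)) ?_
  by_contra! hcon
  have : ∑ i, X t i ≤ ∑ i, X s i :=
    Finset.sum_le_sum fun i hi => hψ.le_iff_le.1 (hcon i hi)
  rw [h.sum_eq hs, h.sum_eq ht] at this
  exact this.not_gt hst

/-- Applying an increasing homeomorphism to all coordinates of an `n`-system and taking the sum of
the coordinates as the new parameter preserves local slopes. -/
lemma IsRegularFrom.exists_reparam {n : ℕ} {X : ℝ → RVec n} {a b : ℝ} (h : IsRegularFrom X a)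
    (hab : a ≤ b) {ψ : ℝ → ℝ} (hψ : StrictMono ψ) (hc : Continuous ψ) :
    ∃ Y : ℝ → RVec n,
      (∀ s ∈ Set.Icc (∑ i, ψ (X a i)) (∑ i, ψ (X b i)),
        ∃ t ∈ Set.Icc a b, ∑ i, ψ (X t i) = s) ∧
      (∀ t ∈ Set.Icc a b, Y (∑ i, ψ (X t i)) = fun i => ψ (X t i)) ∧
      (∀ t ∈ Set.Ico a b, ∀ k, HasRightSlope X t k → HasRightSlope Y (∑ i, ψ (X t i)) k) ∧
      (∀ t ∈ Set.Ioc a b, ∀ ℓ, HasLeftSlope X t ℓ → HasLeftSlope Y (∑ i, ψ (X t i)) ℓ) := by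
  set σ : ℝ → ℝ := fun t => ∑ i, ψ (X t i) with hσ
  have hmono : StrictMonoOn σ (Set.Icc a b) := (h.strictMonoOn_sum hψ).mono Set.Icc_subset_Ici_self
  have hcont : ContinuousOn σ (Set.Icc a b) := by
    refine continuousOn_finsetSum _ fun i _ => hc.comp_continuousOn ?_
    exact (continuous_apply i).comp_continuousOn (h.continuousOn.mono Set.Icc_subset_Ici_self)
  let τ := Function.invFunOn σ (Set.Icc a b)
  have hτ : ∀ t ∈ Set.Icc a b, τ (σ t) = t := fun t ht => hmono.injOn.leftInvOn_invFunOn ht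
  let Y : ℝ → RVec n := fun s i => ψ (X (τ s) i)
  have hY : ∀ t ∈ Set.Icc a b, Y (σ t) = fun i => ψ (X t i) := fun t ht => by
    simp only [Y, hτ t ht]
  have key : ∀ t ∈ Set.Icc a b, ∀ t' ∈ Set.Icc a b, ∀ k : Fin n, X t' = X t + (t' - t) • eVec n k →
      Y (σ t') = Y (σ t) + (σ t' - σ t) • eVec n k := by
    intro t ht t' ht' k hk
    rw [hY t ht, hY t' ht']
    have hne : ∀ i, i ≠ k → ψ (X t' i) = ψ (X t i) := fun i hi => by
      rw [hk]
      simp [hi]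
    have hsum : σ t' - σ t = ψ (X t' k) - ψ (X t k) := by
      simp only [hσ, ← Finset.sum_sub_distrib]
      exact Finset.sum_eq_single k (fun i _ hi => by rw [hne i hi, sub_self]) (by simp)
    ext i
    by_cases hi : i = k
    · simp [hi, hsum]
    · simp [hi, hne i hi]
  have hsurj : ∀ u ∈ Set.Icc a b, ∀ v ∈ Set.Icc a b, u ≤ v → ∀ s ∈ Set.Icc (σ u) (σ v),
      ∃ t ∈ Set.Icc u v, σ t = s := fun u hu v hv huv s hs =>
    intermediate_value_Icc huv (hcont.mono (Set.Icc_subset_Icc hu.1 hv.2)) hs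
  refine ⟨Y, hsurj a ⟨le_rfl, hab⟩ b ⟨hab, le_rfl⟩ hab, hY, fun t ht k hk => ?_,
    fun t ht ℓ hℓ => ?_⟩
  · obtain ⟨u, hu, hX⟩ := hk.exists_Icc ht.2
    have htm : t ∈ Set.Icc a b := Set.Ico_subset_Icc_self ht
    have hum : u ∈ Set.Icc a b := ⟨ht.1.trans hu.1.le, hu.2⟩
    filter_upwards [Icc_mem_nhdsGE (hmono htm hum hu.1)] with s hs
    obtain ⟨t', ht', rfl⟩ := hsurj t htm u hum hu.1.le s hs
    exact key t htm t' ⟨ht.1.trans ht'.1, ht'.2.trans hu.2⟩ k (hX t' ht')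
  · obtain ⟨u, hu, hX⟩ := hℓ.exists_Icc ht.1
    have htm : t ∈ Set.Icc a b := Set.Ioc_subset_Icc_self ht
    have hum : u ∈ Set.Icc a b := ⟨hu.1, hu.2.le.trans ht.2⟩
    filter_upwards [Icc_mem_nhdsLE (hmono hum htm hu.2)] with s hs
    obtain ⟨t', ht', rfl⟩ := hsurj u hum t htm hu.2.le s hs
    exact key t htm t' ⟨hu.1.trans ht'.1, ht'.2.trans ht.2⟩ ℓ (hX t' ht')

/-- `Y` satisfies the conditions of an `n`-system on `(r, s)`, and it has right slope of index `k`
at `r` and left slope of index `ℓ` at `s`. -/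
structure IsSegment {n : ℕ} (Y : ℝ → RVec n) (r s : ℝ) (k ℓ : Fin n) : Prop where
  regular : ∀ q ∈ Set.Ioo r s, ∃ k ℓ, IsRegularAt Y q k ℓ
  right : HasRightSlope Y r k
  left : HasLeftSlope Y s ℓ

/-- A piece of an `n`-system can be rescaled and slightly deformed so that it starts from any
prescribed nearby point with the same coincidences between coordinates. -/
lemma IsRegularFrom.exists_isSegment {n : ℕ} {X : ℝ → RVec n} {a b δ lam : ℝ} {k ℓ k' ℓ' : Fin n}
    {w : RVec n} (h : IsRegularFrom X a) (hab : a < b) (hδ : 0 ≤ δ)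
    (hlam : 0 < lam) (hXa : IsRegularAt X a k ℓ') (hXb : IsRegularAt X b k' ℓ)
    (hb : ∀ i, a < X b i) (hw0 : ∀ i, 0 ≤ w i) (hwm : Monotone w) (hws : ∑ i, w i = a)
    (hw : ∀ i j, w i = w j ↔ X a i = X a j) (hclose : ‖w - X a‖ ≤ δ) :
    ∃ Y : ℝ → RVec n, IsSegment Y (lam * a) (lam * b) k ℓ ∧ Y (lam * a) = lam • w ∧
      Y (lam * b) = lam • X b ∧
      (∀ s ∈ Set.Icc (lam * a) (lam * b), ∑ i, Y s i = s ∧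
        ∃ t ∈ Set.Icc a b, ‖Y s - lam • X t‖ ≤ lam * δ) ∧
      ∀ t ∈ Set.Icc a b, ∃ s ∈ Set.Icc (lam * a) (lam * b), ‖Y s - lam • X t‖ ≤ lam * δ := by
  have hwle : ∀ i, w i ≤ a := fun i =>
    (Finset.single_le_sum (fun j _ => hw0 j) (Finset.mem_univ i)).trans_eq hws
  have hlt : ∀ i j, X a i < X a j ↔ w i < w j := fun i j => by
    rcases le_total i j with hij | hij
    · rw [(hXa.mono hij).lt_iff_ne, (hwm hij).lt_iff_ne, ne_eq, ne_eq, hw]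
    · exact iff_of_false (hXa.mono hij).not_gt (hwm hij).not_gt
  obtain ⟨θ, hθm, hθc, hθv, hθd⟩ := exists_strictMono_extension
    (Sum.elim (X a) (X b)) (Sum.elim w (X b))
    (by
      rintro (i | i) (j | j)
      · exact hlt i j
      · exact iff_of_true ((hXa.apply_le i).trans_lt (hb j)) ((hwle i).trans_lt (hb j))
      · exact iff_of_false ((hXa.apply_le j).trans (hb i).le).not_gt
          ((hwle j).trans (hb i).le).not_gt
      · rfl) hδ
    (by
      rintro (i | i)
      · exact (norm_le_pi_norm (w - X a) i).trans hclose
      · simpa using hδ)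
  have hθa : ∀ i, θ (X a i) = w i := fun i => hθv (.inl i)
  have hθb : ∀ i, θ (X b i) = X b i := fun i => hθv (.inr i)
  have hψm : StrictMono fun x => lam * θ x := fun x y hxy =>
    mul_lt_mul_of_pos_left (hθm hxy) hlam
  obtain ⟨Y, hsurj, hY, hR, hL⟩ := h.exists_reparam hab.le hψm (hθc.const_mul lam)
  have hsm := h.strictMonoOn_sum hψm
  have hσa : ∑ i, lam * θ (X a i) = lam * a := by simp only [hθa, ← Finset.mul_sum, hws]
  have hσb : ∑ i, lam * θ (X b i) = lam * b := by simp only [hθb, ← Finset.mul_sum, hXb.sum]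
  simp only [hσa, hσb] at hsurj
  have ham : a ∈ Set.Icc a b := ⟨le_rfl, hab.le⟩
  have hbm : b ∈ Set.Icc a b := ⟨hab.le, le_rfl⟩
  have hest : ∀ t ∈ Set.Icc a b, ‖Y (∑ i, lam * θ (X t i)) - lam • X t‖ ≤ lam * δ := fun t ht => by
    rw [hY t ht, pi_norm_le_iff_of_nonneg (by positivity)]
    intro i
    simp only [Pi.sub_apply, Pi.smul_apply, smul_eq_mul, ← mul_sub, Real.norm_eq_abs, abs_mul,
      abs_of_pos hlam]
    gcongr
    exact hθd _
  refine ⟨Y, ⟨?_, ?_, ?_⟩, ?_, ?_, ?_, ?_⟩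
  · intro q hq
    obtain ⟨t, ht, rfl⟩ := hsurj q (Set.Ioo_subset_Icc_self hq)
    have hta : a < t := by
      rcases ht.1.eq_or_lt with rfl | h'
      exacts [absurd hq.1 (by rw [hσa]; exact lt_irrefl _), h']
    have htb : t < b := by
      rcases ht.2.eq_or_lt with rfl | h'
      exacts [absurd hq.2 (by rw [hσb]; exact lt_irrefl _), h']
    obtain ⟨k, ℓ, hkl⟩ := h t hta.le
    refine ⟨k, ℓ, ?_, ?_, ?_, hR t ⟨ht.1, htb⟩ k hkl.right, hL t ⟨hta, ht.2⟩ ℓ hkl.left, ?_⟩ <;>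
      rw [hY t ht]
    · intro i
      have h1 : w i ≤ θ (X t i) := by
        rw [← hθa]
        exact hθm.monotone (h.monotoneOn Set.self_mem_Ici ht.1 ht.1 i)
      have := (hw0 i).trans h1
      positivity
    · exact fun i j hij => hψm.monotone (hkl.mono hij)
    · intro hlk i h1 h2
      simp only [hkl.chain hlk i h1 h2]
  · rw [← hσa]
    exact hR a ⟨le_rfl, hab⟩ k hXa.right
  · rw [← hσb]
    exact hL b ⟨hab, le_rfl⟩ ℓ hXb.left
  · rw [← hσa, hY a ham]
    ext i
    simp [hθa]
  · rw [← hσb, hY b hbm]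
    ext i
    simp [hθb]
  · intro s hs
    obtain ⟨t, ht, rfl⟩ := hsurj s hs
    exact ⟨by rw [hY t ht], t, ht, hest t ht⟩
  · intro t ht
    refine ⟨_, ⟨?_, ?_⟩, hest t ht⟩
    · rw [← hσa]
      exact hsm.monotoneOn (Set.mem_Ici.2 le_rfl) ht.1 ht.1
    · rw [← hσb]
      exact hsm.monotoneOn ht.1 (Set.mem_Ici.2 hab.le) ht.2

/-- Consecutive segments with matching end points and compatible slopes can be glued together. -/
lemma exists_glue {n : ℕ} {r : ℕ → ℝ} (hr : StrictMono r) (hr' : Tendsto r atTop atTop)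
    {Y : ℕ → ℝ → RVec n} {k₀ ℓ₀ : Fin n} (hY : ∀ j, IsSegment (Y j) (r j) (r (j + 1)) k₀ ℓ₀)
    (hmatch : ∀ j, Y (j + 1) (r (j + 1)) = Y j (r (j + 1)))
    (hnonneg : ∀ j i, 0 ≤ Y j (r (j + 1)) i) (hmono : ∀ j, Monotone (Y j (r (j + 1))))
    (hsum : ∀ j, ∑ i, Y j (r (j + 1)) i = r (j + 1))
    (hchain : ℓ₀ < k₀ → ∀ j, ∀ i : Fin n, ℓ₀ ≤ i → i ≤ k₀ →
      Y j (r (j + 1)) i = Y j (r (j + 1)) ℓ₀) :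
    ∃ Z : ℝ → RVec n, (∀ j, ∀ q ∈ Set.Icc (r (j + 1)) (r (j + 2)), Z q = Y (j + 1) q) ∧
      ∀ q, r 0 < q → ∃ k ℓ, IsRegularAt Z q k ℓ := by
  have hex : ∀ q, ∃ j, r 0 < q → q ∈ Set.Ioc (r j) (r (j + 1)) := fun q => by
    by_cases hq : r 0 < q
    · obtain ⟨j, hj⟩ := hr.exists_between_of_tendsto_atTop hr' hq
      exact ⟨j, fun _ => hj⟩
    · exact ⟨0, fun h => absurd h hq⟩
  choose N hN using hex
  have hZ : ∀ j, ∀ q ∈ Set.Ioc (r j) (r (j + 1)), Y (N q) q = Y j q := by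
    intro j q hq
    have h1 := hN q ((hr.monotone j.zero_le).trans_lt hq.1)
    have h2 := hr.lt_iff_lt.1 (hq.1.trans_le h1.2)
    have h3 := hr.lt_iff_lt.1 (h1.1.trans_le hq.2)
    rw [show N q = j by omega]
  have hZ' : ∀ j, ∀ q ∈ Set.Icc (r (j + 1)) (r (j + 2)), Y (N q) q = Y (j + 1) q := by
    intro j q hq
    rcases hq.1.eq_or_lt with rfl | hlt
    · rw [hZ j _ ⟨hr (Nat.lt_succ_self j), le_rfl⟩, hmatch]
    · exact hZ (j + 1) q ⟨hlt, hq.2⟩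
  refine ⟨fun q => Y (N q) q, hZ', fun q hq => ?_⟩
  obtain ⟨j, hj1, hj2⟩ := hr.exists_between_of_tendsto_atTop hr' hq
  rcases hj2.lt_or_eq with hlt | rfl
  · obtain ⟨k, ℓ, h⟩ := (hY j).regular q ⟨hj1, hlt⟩
    refine ⟨k, ℓ, h.congr ?_⟩
    filter_upwards [Ioo_mem_nhds hj1 hlt] with t ht using hZ j t (Set.Ioo_subset_Ioc_self ht)
  · refine ⟨k₀, ℓ₀, ?_, ?_, ?_, ?_, ?_, ?_⟩
    · rw [hZ j _ ⟨hj1, le_rfl⟩]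
      exact hnonneg j
    · rw [hZ j _ ⟨hj1, le_rfl⟩]
      exact hmono j
    · rw [hZ j _ ⟨hj1, le_rfl⟩]
      exact hsum j
    · refine (hY (j + 1)).right.congr ?_
      filter_upwards [Ico_mem_nhdsGE (hr (Nat.lt_succ_self (j + 1)))] with t ht using
        hZ' j t (Set.Ico_subset_Icc_self ht)
    · refine (hY j).left.congr ?_
      filter_upwards [Ioc_mem_nhdsLE hj1] with t ht using hZ j t ht
    · rw [hZ j _ ⟨hj1, le_rfl⟩]
      exact fun hlk => hchain hlk j

lemma liminf_eq_iff_of_bounded {f : ℝ → ℝ} {K y : ℝ} (hf : ∀ᶠ q in atTop, |f q| ≤ K) :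
    liminf f atTop = y ↔
      ∀ ε > 0, (∀ᶠ q in atTop, y - ε ≤ f q) ∧ ∃ᶠ q in atTop, f q ≤ y + ε := by
  have h1 : IsBoundedUnder (· ≥ ·) atTop f :=
    isBoundedUnder_of_eventually_ge (hf.mono fun q hq => (abs_le.1 hq).1)
  have h2 : IsBoundedUnder (· ≤ ·) atTop f :=
    isBoundedUnder_of_eventually_le (hf.mono fun q hq => (abs_le.1 hq).2)
  constructor
  · rintro rfl ε hε
    exact ⟨(eventually_lt_of_lt_liminf (sub_lt_self _ hε) h1).mono fun q hq => hq.le,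
      (frequently_lt_of_liminf_lt h2.isCoboundedUnder_ge (lt_add_of_pos_right _ hε)).mono
        fun q hq => hq.le⟩
  · intro h
    refine le_antisymm (le_of_forall_pos_le_add fun ε hε => ?_)
      (le_of_forall_pos_le_add fun ε hε => ?_)
    · exact liminf_le_of_frequently_le (h ε hε).2 h1
    · rw [← sub_le_iff_le_add]
      exact le_liminf_of_le h2.isCoboundedUnder_ge (h ε hε).1

lemma IsLinearMap.exists_bound {n m : ℕ} {T : RVec n → RVec m} (hT : IsLinearMap ℝ T) :
    ∃ C : ℝ, 0 ≤ C ∧ ∀ v j, |T v j| ≤ C * ‖v‖ := by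
  let L := (hT.mk' T).toContinuousLinearMap
  exact ⟨‖L‖, norm_nonneg _, fun v j => (norm_le_pi_norm (T v) j).trans (L.le_opNorm v)⟩

lemma IsRegularAt.norm_le {n : ℕ} {X : ℝ → RVec n} {q : ℝ} {k ℓ : Fin n}
    (h : IsRegularAt X q k ℓ) : ‖X q‖ ≤ q := by
  refine (pi_norm_le_iff_of_nonneg ((h.nonneg k).trans (h.apply_le k))).2 fun i => ?_
  rw [Real.norm_of_nonneg (h.nonneg i)]
  exact h.apply_le i

lemma IsRegularFrom.abs_apply_le {n m : ℕ} {T : RVec n → RVec m} {C : ℝ}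
    (hC0 : 0 ≤ C) (hC : ∀ v j, |T v j| ≤ C * ‖v‖) {P : ℝ → RVec n} {c : ℝ}
    (hP : IsRegularFrom P c) {q : ℝ} (hq : c ≤ q) (j : Fin m) : |T (P q) j| ≤ C * q := by
  obtain ⟨k, ℓ, h⟩ := hP q hq
  exact (hC _ j).trans (mul_le_mul_of_nonneg_left h.norm_le hC0)

lemma muT_eq_iff {n m : ℕ} {T : RVec n → RVec m} (hT : IsLinearMap ℝ T) {I : Set ℝ}
    {P : ℝ → RVec n} {c : ℝ} (hI : Set.Ici c ⊆ I) (hP : IsRegularFrom P c) {y : RVec m} :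
    muT n m T I P = y ↔ ∀ j, ∀ ε > 0, (∀ᶠ q in atTop, (y j - ε) * q ≤ T (P q) j) ∧
      ∃ᶠ q in atTop, T (P q) j ≤ (y j + ε) * q := by
  obtain ⟨C, hC0, hC⟩ := hT.exists_bound
  have hF : atTop ⊓ 𝓟 I = (atTop : Filter ℝ) :=
    inf_eq_left.2 (le_principal_iff.2 (mem_of_superset (Ici_mem_atTop c) hI))
  rw [funext_iff]
  refine forall_congr' fun j => ?_
  have hb : ∀ᶠ q in atTop, |T (P q) j / q| ≤ C := by
    filter_upwards [eventually_ge_atTop c, eventually_gt_atTop 0] with q hq hq0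
    rw [abs_div, abs_of_pos hq0, div_le_iff₀ hq0]
    exact hP.abs_apply_le hC0 hC hq j
  rw [muT, hF, liminf_eq_iff_of_bounded hb]
  have hpos := eventually_gt_atTop (0 : ℝ)
  refine forall₂_congr fun ε _ => and_congr (eventually_congr ?_) (frequently_congr ?_)
  · filter_upwards [hpos] with q hq using le_div_iff₀ hq
  · filter_upwards [hpos] with q hq using div_le_iff₀ hq

lemma IsProperSys.eventually_lt {n : ℕ} {I : Set ℝ} {P : ℝ → RVec n} (h : IsProperSys n I P)
    {c : ℝ} (hP : IsRegularFrom P c) (M : ℝ) :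
    ∀ᶠ q in atTop, ∀ i, M < P q i := by
  rcases isEmpty_or_nonempty (Fin n) with hn | ⟨⟨i₀⟩⟩
  · exact .of_forall fun q i => hn.elim i
  obtain ⟨q, hq, hM⟩ := h.2 (max M c)
  have hqc : c ≤ q := by
    have h1 := Finset.single_le_sum (f := P q) (fun j _ => (h.1.2.2.2 q hq).1.1 j)
      (Finset.mem_univ i₀)
    rw [(h.1.2.2.2 q hq).1.2.2] at h1
    exact (le_max_right _ _).trans ((hM i₀).le.trans h1)
  filter_upwards [eventually_ge_atTop q] with t ht i
  exact ((le_max_left _ _).trans_lt (hM i)).trans_le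
    (hP.monotoneOn hqc (hqc.trans ht) ht i)

lemma Ultrafilter.exists_eventually_eq_of_finite {α β : Type*} [Finite β] (U : Ultrafilter α)
    (f : α → β) : ∃ c, ∀ᶠ a in (U : Filter α), f a = c := by
  obtain ⟨c, hc⟩ := (U.map f).eq_pure_of_finite
  refine ⟨c, ?_⟩
  have h : {c} ∈ U.map f := by
    rw [hc]
    exact Set.mem_singleton c
  exact h

/-- A piece `X` on `[a, b]` of an `n`-system, with the same slopes `k`, `ℓ` and the same
coincidence set `R` at both ends, with both ends having direction close to `x`, and along which the
infimum of `T (X t) / t` is close to `y`. -/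
structure IsPiece {n m : ℕ} (T : RVec n → RVec m) (y : RVec m) (k ℓ : Fin n)
    (R : Set (Fin n × Fin n)) (x : RVec n) (ε : ℝ) (X : ℝ → RVec n) (a b : ℝ) : Prop where
  pos : 0 < a
  regular : IsRegularFrom X a
  regular_left : IsRegularAt X a k ℓ
  regular_right : IsRegularAt X b k ℓ
  lt : ∀ i, a < X b i
  eq_left : ∀ i j, X a i = X a j ↔ (i, j) ∈ R
  eq_right : ∀ i j, X b i = X b j ↔ (i, j) ∈ R
  near_left : ‖X a - a • x‖ ≤ ε * a
  near_right : ‖X b - b • x‖ ≤ ε * b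
  lower : ∀ t, a ≤ t → ∀ j, (y j - ε) * t ≤ T (X t) j
  upper : ∀ j, ∃ t ∈ Set.Icc a b, T (X t) j ≤ (y j + ε) * t

lemma exists_isPiece {n m : ℕ} (hn : 2 ≤ n) {T : RVec n → RVec m} (hT : IsLinearMap ℝ T)
    {y : RVec m} {u : ℕ → RVec m} (hu : ∀ l, ∃ I P, IsProperSys n I P ∧ muT n m T I P = u l)
    (huy : Tendsto u atTop (𝓝 y)) :
    ∃ k ℓ R x, ∀ ε > 0, ∃ X a b, IsPiece T y k ℓ R x ε X a b := by
  choose I P hP hmu using hu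
  choose c hc0 hcI hreg using fun l => (hP l).exists_isRegularFrom hn
  let U : Ultrafilter ℝ := Ultrafilter.of atTop
  have hU : (U : Filter ℝ) ≤ atTop := Ultrafilter.of_le atTop
  let V : Ultrafilter ℕ := Ultrafilter.of atTop
  have hV : (V : Filter ℕ) ≤ atTop := Ultrafilter.of_le atTop
  have hslopes : ∀ l, ∃ s : Fin n × Fin n × Set (Fin n × Fin n), ∀ᶠ q in (U : Filter ℝ),
      IsRegularAt (P l) q s.1 s.2.1 ∧ ∀ i j, P l q i = P l q j ↔ (i, j) ∈ s.2.2 := by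
    intro l
    have hex : ∀ q, ∃ s : Fin n × Fin n × Set (Fin n × Fin n), c l ≤ q →
        IsRegularAt (P l) q s.1 s.2.1 ∧ ∀ i j, P l q i = P l q j ↔ (i, j) ∈ s.2.2 := by
      intro q
      by_cases hq : c l ≤ q
      · obtain ⟨k, ℓ, h⟩ := hreg l q hq
        exact ⟨(k, ℓ, {p | P l q p.1 = P l q p.2}), fun _ => ⟨h, fun i j => Iff.rfl⟩⟩
      · exact ⟨(⟨0, by omega⟩, ⟨0, by omega⟩, ∅), fun h => absurd h hq⟩
    choose f hf using hex
    obtain ⟨s, hs⟩ := U.exists_eventually_eq_of_finite f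
    refine ⟨s, ?_⟩
    filter_upwards [hs, hU (eventually_ge_atTop (c l))] with q h1 h2
    rw [← h1]
    exact hf q h2
  choose s hs using hslopes
  have hdir : ∀ l, ∃ x ∈ Metric.closedBall (0 : RVec n) 1,
      Tendsto (fun q => q⁻¹ • P l q) U (𝓝 x) := by
    intro l
    refine (isCompact_closedBall (0 : RVec n) 1).ultrafilter_le_nhds
      (U.map fun q => q⁻¹ • P l q) (le_principal_iff.2 ?_)
    refine Ultrafilter.mem_map.2 ?_
    filter_upwards [hU (eventually_ge_atTop (c l))] with q hq
    have hq0 := (hc0 l).trans_le hq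
    obtain ⟨k, ℓ, h⟩ := hreg l q hq
    rw [Set.mem_preimage, mem_closedBall_zero_iff, norm_smul, norm_inv, Real.norm_of_nonneg hq0.le,
      inv_mul_le_iff₀ hq0, mul_one]
    exact h.norm_le
  choose z hz hPz using hdir
  obtain ⟨x, -, hx⟩ := (isCompact_closedBall (0 : RVec n) 1).ultrafilter_le_nhds (V.map z)
    (le_principal_iff.2 (Ultrafilter.mem_map.2 (univ_mem' hz)))
  have hx : Tendsto z V (𝓝 x) := hx
  obtain ⟨⟨k, ℓ, R⟩, hk⟩ := V.exists_eventually_eq_of_finite s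
  refine ⟨k, ℓ, R, x, fun ε hε => ?_⟩
  obtain ⟨l, hl1, hl2, hl3⟩ := (hk.and ((hx.eventually (Metric.ball_mem_nhds x (half_pos hε))).and
    ((huy.mono_left hV).eventually (Metric.ball_mem_nhds y (half_pos hε))))).exists
  have hsl := hs l
  rw [hl1] at hsl
  have hyu : ∀ j, |u l j - y j| ≤ ε / 2 := fun j =>
    (norm_le_pi_norm (u l - y) j).trans (by rw [← dist_eq_norm]; exact (Metric.mem_ball.1 hl3).le)
  have hlim := (muT_eq_iff hT (hcI l) (hreg l)).1 (hmu l)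
  have hnear : ∀ᶠ q in (U : Filter ℝ), ‖P l q - q • x‖ ≤ ε * q := by
    filter_upwards [(hPz l).eventually (Metric.ball_mem_nhds (z l) (half_pos hε)),
      hU (eventually_gt_atTop 0)] with q h1 h2
    have h3 : ‖q⁻¹ • P l q - x‖ ≤ ε := by
      rw [← dist_eq_norm]
      have := dist_triangle (q⁻¹ • P l q) (z l) x
      have := Metric.mem_ball.1 h1
      have := Metric.mem_ball.1 hl2
      linarith
    calc ‖P l q - q • x‖ = ‖q • (q⁻¹ • P l q - x)‖ := by
          rw [smul_sub, smul_inv_smul₀ h2.ne']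
      _ = q * ‖q⁻¹ • P l q - x‖ := by rw [norm_smul, Real.norm_of_nonneg h2.le]
      _ ≤ ε * q := by
          rw [mul_comm]
          gcongr
  have hlow : ∀ᶠ a in atTop, ∀ t, a ≤ t → ∀ j, (y j - ε) * t ≤ T (P l t) j := by
    refine eventually_forall_ge_atTop.2 (eventually_all.2 fun j => ?_)
    filter_upwards [(hlim j (ε / 2) (half_pos hε)).1, eventually_ge_atTop 0] with t h1 h2
    refine le_trans (mul_le_mul_of_nonneg_right ?_ h2) h1
    linarith [(abs_le.1 (hyu j)).1]
  obtain ⟨a, ⟨ha1, ha2⟩, ha3, ha4, ha5⟩ := (hsl.and (hnear.and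
    (hU (hlow.and (eventually_ge_atTop (c l)))))).exists
  have ha0 : 0 < a := (hc0 l).trans_le ha5
  have hup : ∀ j, ∃ t, a ≤ t ∧ T (P l t) j ≤ (y j + ε) * t := fun j => by
    obtain ⟨t, h1, h2⟩ := ((hlim j (ε / 2) (half_pos hε)).2.and_eventually
      (eventually_ge_atTop a)).exists
    refine ⟨t, h2, h1.trans (mul_le_mul_of_nonneg_right ?_ (ha0.le.trans h2))⟩
    linarith [(abs_le.1 (hyu j)).2]
  choose t hta htu using hup
  obtain ⟨b, ⟨hb1, hb2⟩, hb3, hb4, hb5⟩ := (hsl.and (hnear.and (hU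
    (((hP l).eventually_lt (hreg l) a).and
      (eventually_all.2 fun j => eventually_ge_atTop (t j)))))).exists
  exact ⟨P l, a, b, ha0, (hreg l).mono_left ha5, ha1, hb1, hb4, ha2, hb2, ha3, hb3, ha4,
    fun j => ⟨t j, ⟨hta j, hb5 j⟩, htu j⟩⟩

lemma IsPiece.two_mul_le {n m : ℕ} (hn : 2 ≤ n) {T : RVec n → RVec m} {y : RVec m} {k ℓ : Fin n}
    {R : Set (Fin n × Fin n)} {x : RVec n} {ε : ℝ} {X : ℝ → RVec n} {a b : ℝ}
    (h : IsPiece T y k ℓ R x ε X a b) : 2 * a ≤ b := by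
  have h1 : ∑ _i : Fin n, a ≤ ∑ i, X b i := Finset.sum_le_sum fun i _ => (h.lt i).le
  rw [h.regular_right.sum, Finset.sum_const, Finset.card_univ, Fintype.card_fin,
    nsmul_eq_mul] at h1
  have h2 : (2 : ℝ) ≤ n := by exact_mod_cast hn
  nlinarith [h.pos]

/-- Moving `v` to a nearby point `w` changes `T v - (∑ i, v i) • y` by a controlled amount. -/
lemma IsLinearMap.abs_sub_le {n m : ℕ} {T : RVec n → RVec m} (hT : IsLinearMap ℝ T) {C η : ℝ}
    (hC0 : 0 ≤ C) (hC : ∀ v j, |T v j| ≤ C * ‖v‖) (y : RVec m) {v w : RVec n}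
    (hvw : ‖w - v‖ ≤ η) (j : Fin m) :
    |∑ i, w i - ∑ i, v i| ≤ n * η ∧
      |T w j - y j * ∑ i, w i - (T v j - y j * ∑ i, v i)| ≤ (C + ‖y‖ * n) * η := by
  have h1 : |∑ i, w i - ∑ i, v i| ≤ n * η := by
    rw [← Finset.sum_sub_distrib]
    refine (Finset.abs_sum_le_sum_abs _ _).trans ?_
    refine (Finset.sum_le_card_nsmul _ _ η fun i _ =>
      (norm_le_pi_norm (w - v) i).trans hvw).trans_eq ?_
    simp
  refine ⟨h1, ?_⟩
  have h2 : |T w j - T v j| ≤ C * η := by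
    have := hC (w - v) j
    rw [hT.map_sub, Pi.sub_apply] at this
    exact this.trans (by gcongr)
  have h3 : |y j * (∑ i, w i - ∑ i, v i)| ≤ ‖y‖ * (n * η) := by
    rw [abs_mul]
    exact mul_le_mul (norm_le_pi_norm y j) h1 (abs_nonneg _) (norm_nonneg _)
  calc _ = |(T w j - T v j) - y j * (∑ i, w i - ∑ i, v i)| := by congr 1; ring
    _ ≤ |T w j - T v j| + |y j * (∑ i, w i - ∑ i, v i)| := abs_sub _ _
    _ ≤ C * η + ‖y‖ * (n * η) := add_le_add h2 h3
    _ = _ := by ring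

/-- Closeness of `T v` to `(∑ i, v i) • y`, from below or from above, persists at points `w` near
`v`, up to a constant factor. -/
lemma IsLinearMap.bounds_of_norm_sub_le {n m : ℕ} {T : RVec n → RVec m} (hT : IsLinearMap ℝ T)
    {C ε τ : ℝ} (hC0 : 0 ≤ C) (hC : ∀ v j, |T v j| ≤ C * ‖v‖) (y : RVec m) {v w : RVec n}
    (hε : 0 ≤ ε) (hnε : 4 * (n * ε) ≤ 1) (hτ : 0 ≤ τ) (hv : ∑ i, v i = τ)
    (hvw : ‖w - v‖ ≤ 2 * ε * τ) (j : Fin m) :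
    ((y j - ε) * τ ≤ T v j →
      (y j - (2 + 4 * (C + ‖y‖ * n)) * ε) * ∑ i, w i ≤ T w j) ∧
    (T v j ≤ (y j + ε) * τ →
      T w j ≤ (y j + (2 + 4 * (C + ‖y‖ * n)) * ε) * ∑ i, w i) := by
  obtain ⟨h1, h2⟩ := hT.abs_sub_le hC0 hC y hvw j
  rw [hv] at h1 h2
  set s := ∑ i, w i
  set K := C + ‖y‖ * n
  have hK0 : 0 ≤ K := by positivity
  rw [abs_le] at h1 h2
  have h3 : τ ≤ 2 * s := by nlinarith [h1.1]
  have h4 : (ε + 2 * K * ε) * τ ≤ (ε + 2 * K * ε) * (2 * s) := by gcongr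
  constructor <;> intro h5
  · linarith [h2.1]
  · linarith [h2.2]

/-- Pieces with compatible ends, and with errors tending to `0`, can be rescaled, deformed and glued
into a proper `n`-system with exponents `y`. -/
lemma exists_isProperSys_of_isPiece {n m : ℕ} (hn : 2 ≤ n) {T : RVec n → RVec m}
    (hT : IsLinearMap ℝ T) {y : RVec m} {k ℓ : Fin n} {R : Set (Fin n × Fin n)} {x : RVec n}
    (h : ∀ ε > 0, ∃ X a b, IsPiece T y k ℓ R x ε X a b) :
    ∃ I P, IsProperSys n I P ∧ muT n m T I P = y := by
  obtain ⟨C, hC0, hC⟩ := hT.exists_bound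
  have hn0 : (0 : ℝ) < n := by exact_mod_cast (by omega : 0 < n)
  let ε : ℕ → ℝ := fun j => (4 * (n : ℝ))⁻¹ * (1 / ((j : ℝ) + 1))
  have hε : ∀ j, 0 < ε j := fun j => by positivity
  have hεlim : Tendsto ε atTop (𝓝 0) := by
    simpa only [mul_zero] using
      tendsto_one_div_add_atTop_nhds_zero_nat.const_mul ((4 * (n : ℝ))⁻¹)
  have hεanti : ∀ j, ε (j + 1) ≤ ε j := fun j =>
    mul_le_mul_of_nonneg_left (Nat.one_div_le_one_div j.le_succ) (by positivity)
  have hεn : ∀ j, 4 * (n * ε j) ≤ 1 := fun j => by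
    have h1 : (1 : ℝ) / ((j : ℝ) + 1) ≤ 1 := by
      rw [div_le_one (by positivity)]
      linarith [(Nat.cast_nonneg j : (0 : ℝ) ≤ j)]
    calc 4 * (n * ε j) = 1 / ((j : ℝ) + 1) := by simp only [ε]; field_simp
      _ ≤ 1 := h1
  choose X a b hX using fun j => h (ε j) (hε j)
  have ha : ∀ j, 0 < a j := fun j => (hX j).pos
  have hab : ∀ j, 2 * a j ≤ b j := fun j => (hX j).two_mul_le hn
  have hb : ∀ j, 0 < b j := fun j => by linarith [ha j, hab j]
  let lam : ℕ → ℝ := fun j => Nat.rec 1 (fun j l => l * b (j + 1) / a (j + 2)) j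
  have hlam_succ : ∀ j, lam (j + 1) = lam j * b (j + 1) / a (j + 2) := fun j => rfl
  have hlam : ∀ j, 0 < lam j := fun j => by
    induction j with
    | zero => exact one_pos
    | succ j ih =>
      rw [hlam_succ]
      exact div_pos (mul_pos ih (hb _)) (ha _)
  let r : ℕ → ℝ := fun j => lam j * a (j + 1)
  have hr_succ : ∀ j, r (j + 1) = lam j * b (j + 1) := fun j => by
    simp only [r, hlam_succ]
    exact div_mul_cancel₀ _ (ha _).ne'
  have hr0 : ∀ j, 0 < r j := fun j => mul_pos (hlam j) (ha _)
  have hr2 : ∀ j, 2 * r j ≤ r (j + 1) := fun j => by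
    rw [hr_succ]
    calc 2 * r j = lam j * (2 * a (j + 1)) := by simp only [r]; ring
      _ ≤ _ := mul_le_mul_of_nonneg_left (hab _) (hlam j).le
  have hrm : StrictMono r := strictMono_nat_of_lt_succ fun j => by linarith [hr0 j, hr2 j]
  have hrt : Tendsto r atTop atTop := by
    refine tendsto_atTop_mono (f := fun j : ℕ => 2 ^ j * r 0) (fun j => ?_)
      ((tendsto_pow_atTop_atTop_of_one_lt one_lt_two).atTop_mul_const (hr0 0))
    induction j with
    | zero => simp
    | succ j ih =>
      calc 2 ^ (j + 1) * r 0 = 2 * (2 ^ j * r 0) := by ring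
        _ ≤ _ := by linarith [hr2 j]
  let w : ℕ → RVec n := fun j => (a (j + 1) / b j) • X j (b j)
  have hc : ∀ j, 0 < a (j + 1) / b j := fun j => div_pos (ha _) (hb _)
  have hclose : ∀ j, ‖w j - X (j + 1) (a (j + 1))‖ ≤ 2 * ε j * a (j + 1) := fun j => by
    calc ‖w j - X (j + 1) (a (j + 1))‖
        = ‖(a (j + 1) / b j) • (X j (b j) - b j • x)
            - (X (j + 1) (a (j + 1)) - a (j + 1) • x)‖ := by
          rw [smul_sub, smul_smul, div_mul_cancel₀ _ (hb j).ne']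
          congr 1
          simp only [w]
          abel
      _ ≤ a (j + 1) / b j * ‖X j (b j) - b j • x‖ + ‖X (j + 1) (a (j + 1)) - a (j + 1) • x‖ := by
          refine (norm_sub_le _ _).trans_eq ?_
          rw [norm_smul, Real.norm_of_nonneg (hc j).le]
      _ ≤ a (j + 1) / b j * (ε j * b j) + ε j * a (j + 1) := by
          refine add_le_add (mul_le_mul_of_nonneg_left (hX j).near_right (hc j).le)
            ((hX (j + 1)).near_left.trans ?_)
          exact mul_le_mul_of_nonneg_right (hεanti j) (ha _).le
      _ = 2 * ε j * a (j + 1) := by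
          have := (hb j).ne'
          field_simp
          ring
  have hseg := fun j => (hX (j + 1)).regular.exists_isSegment (w := w j)
    (δ := 2 * ε j * a (j + 1)) (by linarith [ha (j + 1), hab (j + 1)])
    (by have := ha (j + 1); have := hε j; positivity)
    (hlam j) (hX (j + 1)).regular_left (hX (j + 1)).regular_right (hX (j + 1)).lt
    (fun i => mul_nonneg (hc j).le ((hX j).regular_right.nonneg i))
    (fun i i' hi => mul_le_mul_of_nonneg_left ((hX j).regular_right.mono hi) (hc j).le)
    (by
      simp only [w, Pi.smul_apply, smul_eq_mul, ← Finset.mul_sum, (hX j).regular_right.sum]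
      exact div_mul_cancel₀ _ (hb j).ne')
    (fun i i' => by
      simp only [w, Pi.smul_apply, smul_eq_mul]
      rw [mul_right_inj' (hc j).ne', (hX j).eq_right, (hX (j + 1)).eq_left])
    (hclose j)
  choose Y hYseg hYa hYb hY1 hY2 using hseg
  simp only [← hr_succ] at hYseg hYb hY1 hY2
  have hYr : ∀ j i, Y j (r (j + 1)) i = lam j * X (j + 1) (b (j + 1)) i := fun j i => by
    rw [hYb]
    rfl
  obtain ⟨Z, hZY, hZ⟩ := exists_glue hrm hrt hYseg
    (fun j => by
      rw [hYb, show r (j + 1) = lam (j + 1) * a (j + 2) from rfl, hYa (j + 1)]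
      simp only [w, smul_smul]
      congr 1
      rw [hlam_succ]
      have h1 := (ha (j + 2)).ne'
      have h2 := (hb (j + 1)).ne'
      field_simp)
    (fun j i => by
      rw [hYr]
      exact mul_nonneg (hlam j).le ((hX (j + 1)).regular_right.nonneg i))
    (fun j i i' hi => by
      rw [hYr, hYr]
      exact mul_le_mul_of_nonneg_left ((hX (j + 1)).regular_right.mono hi) (hlam j).le)
    (fun j => by
      simp only [hYr, ← Finset.mul_sum, (hX (j + 1)).regular_right.sum]
      exact (hr_succ j).symm)
    (fun hlk j i h1 h2 => by
      rw [hYr, hYr, (hX (j + 1)).regular_right.chain hlk i h1 h2])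
  have hest : ∀ j, ∀ s ∈ Set.Icc (r j) (r (j + 1)), ∀ t ∈ Set.Icc (a (j + 1)) (b (j + 1)),
      ‖Y j s - lam j • X (j + 1) t‖ ≤ lam j * (2 * ε j * a (j + 1)) → ∀ i,
      ((y i - ε j) * t ≤ T (X (j + 1) t) i →
        (y i - (2 + 4 * (C + ‖y‖ * n)) * ε j) * s ≤ T (Y j s) i) ∧
      (T (X (j + 1) t) i ≤ (y i + ε j) * t →
        T (Y j s) i ≤ (y i + (2 + 4 * (C + ‖y‖ * n)) * ε j) * s) := by
    intro j s hs t ht hst i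
    have ht0 : 0 ≤ t := (ha _).le.trans ht.1
    have hsum : ∑ i, (lam j • X (j + 1) t) i = lam j * t := by
      simp only [Pi.smul_apply, smul_eq_mul, ← Finset.mul_sum, (hX (j + 1)).regular.sum_eq ht.1]
    have hTs : T (lam j • X (j + 1) t) i = lam j * T (X (j + 1) t) i := by
      rw [hT.map_smul]
      rfl
    have := hT.bounds_of_norm_sub_le hC0 hC y (hε j).le (hεn j) (mul_nonneg (hlam j).le ht0) hsum
      (hst.trans (by
        have := (hlam j).le
        have := (hε j).le
        calc lam j * (2 * ε j * a (j + 1)) ≤ lam j * (2 * ε j * t) := by gcongr; exact ht.1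
          _ = _ := by ring)) i
    rw [(hY1 j s hs).1, hTs, mul_left_comm, mul_left_comm (y i + ε j),
      mul_le_mul_iff_right₀ (hlam j), mul_le_mul_iff_right₀ (hlam j)] at this
    exact this
  have hbound : ∀ η > 0, ∀ᶠ j in atTop, (2 + 4 * (C + ‖y‖ * n)) * ε j ≤ η := fun η hη => by
    have := hεlim.const_mul (2 + 4 * (C + ‖y‖ * n))
    rw [mul_zero] at this
    exact this.eventually (ge_mem_nhds hη)
  refine ⟨Set.Ioi (r 0), Z, isProperSys_Ioi (hr0 0).le hZ fun M => ?_, ?_⟩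
  · obtain ⟨j, hj⟩ := (hrt.eventually_ge_atTop M).exists
    refine ⟨r (j + 2), hrm (show 0 < j + 2 by omega), fun i => ?_⟩
    rw [hZY j _ ⟨(hrm (Nat.lt_succ_self (j + 1))).le, le_rfl⟩, hYr]
    calc M ≤ r j := hj
      _ < r (j + 1) := hrm (Nat.lt_succ_self _)
      _ = lam (j + 1) * a (j + 2) := rfl
      _ < _ := mul_lt_mul_of_pos_left ((hX (j + 2)).lt i) (hlam (j + 1))
  · have hr01 : r 0 < r 1 := hrm Nat.zero_lt_one
    refine (muT_eq_iff (c := r 1) hT (fun t ht => hr01.trans_le ht)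
      fun q hq => hZ q (hr01.trans_le hq)).2 fun i η hη => ⟨?_, frequently_atTop.2 fun M => ?_⟩
    · obtain ⟨J, hJ⟩ := eventually_atTop.1 (hbound η hη)
      filter_upwards [eventually_gt_atTop (r (J + 1))] with q hq
      obtain ⟨l, hl1, hl2⟩ := hrm.exists_between_of_tendsto_atTop hrt
        ((hrm.monotone (Nat.zero_le (J + 1))).trans_lt hq)
      have hl3 : J + 1 < l + 1 := hrm.lt_iff_lt.1 (hq.trans_le hl2)
      obtain ⟨j, rfl⟩ : ∃ j, l = j + 1 := ⟨l - 1, by omega⟩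
      have hqm : q ∈ Set.Icc (r (j + 1)) (r (j + 1 + 1)) := ⟨hl1.le, hl2⟩
      rw [hZY j q hqm]
      obtain ⟨t, ht, hst⟩ := (hY1 (j + 1) q hqm).2
      refine le_trans (mul_le_mul_of_nonneg_right ?_ ((hr0 (j + 1)).le.trans hl1.le))
        ((hest (j + 1) q hqm t ht hst i).1 (le_trans (mul_le_mul_of_nonneg_right ?_
          ((ha _).le.trans ht.1)) ((hX (j + 2)).lower t ht.1 i)))
      · linarith [hJ (j + 1) (by omega)]
      · linarith [hεanti (j + 1)]
    · obtain ⟨j, hj1, hj2⟩ := ((hrt.eventually_ge_atTop M).and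
        ((tendsto_add_atTop_nat 1).eventually (hbound η hη))).exists
      obtain ⟨t, ht, htu⟩ := (hX (j + 2)).upper i
      obtain ⟨s, hs, hst⟩ := hY2 (j + 1) t ht
      have hs : s ∈ Set.Icc (r (j + 1)) (r (j + 1 + 1)) := hs
      refine ⟨s, hj1.trans ((hrm (Nat.lt_succ_self j)).le.trans hs.1), ?_⟩
      rw [hZY j s hs]
      refine ((hest (j + 1) s hs t ht hst i).2 (htu.trans (mul_le_mul_of_nonneg_right ?_
        ((ha _).le.trans ht.1)))).trans (mul_le_mul_of_nonneg_right ?_ ((hr0 (j + 1)).le.trans hs.1))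
      · linarith [hεanti (j + 1)]
      · linarith [hj2]

/-- **Corollary (compactness of the spectrum).** For a linear map `T : ℝ^n → ℝ^m`,
the spectrum `{μ_T(P) : P a proper n-system}` is a compact subset of `ℝ^m`. -/
theorem spectrum_isCompact (n m : ℕ) (hn : 2 ≤ n)
    (T : RVec n → RVec m) (hT : IsLinearMap ℝ T) :
    IsCompact {y : RVec m | ∃ I P, IsProperSys n I P ∧ muT n m T I P = y} := by
  refine Metric.isCompact_of_isClosed_isBounded (IsSeqClosed.isClosed fun u y hu huy => ?_) ?_
  · obtain ⟨k, ℓ, R, x, h⟩ := exists_isPiece hn hT hu huy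
    exact exists_isProperSys_of_isPiece hn hT h
  · obtain ⟨C, hC0, hC⟩ := hT.exists_bound
    refine (Metric.isBounded_closedBall (x := (0 : RVec m)) (r := C + 1)).subset ?_
    rintro y ⟨I, P, hP, hy⟩
    obtain ⟨c, hc, hI, hreg⟩ := hP.exists_isRegularFrom hn
    rw [mem_closedBall_zero_iff, pi_norm_le_iff_of_nonneg (by positivity)]
    intro j
    obtain ⟨h1, h2⟩ := (muT_eq_iff hT hI hreg).1 hy j 1 one_pos
    rw [Real.norm_eq_abs, abs_le]
    constructor
    · obtain ⟨q, hq, hqc⟩ := (h2.and_eventually (eventually_ge_atTop c)).exists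
      have := (abs_le.1 (hreg.abs_apply_le hC0 hC hqc j)).1
      nlinarith
    · obtain ⟨q, hq, hqc⟩ := (h1.and (eventually_ge_atTop c)).exists
      have := (abs_le.1 (hreg.abs_apply_le hC0 hC hqc j)).2
      nlinarith
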